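/- arXiv:math/0312489 — 3 statements merged into one kernel-verified Lean document; each statement's English description precedes it below -/
import Mathlib

section
/- Let F be a finite field, n a positive integer, and A ∈ GL_n(F) a regular matrix (i.e., the centralizer of A in M_n(F) has F-dimension n). If V = F^n, viewed as an F[A]-module, decomposes as a direct sum V = ⊕_i V_i of F[A]-submodules, then the quotient M_n(F)/[M_n(F), A] decomposes as the direct sum ⊕_i End(V_i)/[End(V_i), A|_{V_i}], where [M, A] denotes the F-span of all commutators m·a − a·m with m in the respective endomorphism space and a the action of A. -/
/-- A finitely generated torsion module over a principal ideal domain embeds linearly into its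
module of endomorphisms, via the ring structure on a product of cyclic modules. -/
theorem Module.exists_injective_end_of_isTorsion {R M : Type*} [CommRing R] [IsDomain R]
    [IsPrincipalIdealRing R] [AddCommGroup M] [Module R M] [Module.Finite R M]
    (hM : Module.IsTorsion R M) :
    ∃ m : M →ₗ[R] Module.End R M, Function.Injective m := by
  classical
  obtain ⟨ι, _, p, -, k, ⟨e⟩⟩ := Module.equiv_directSum_of_isTorsion hM
  let P := Π i, R ⧸ Ideal.span {p i ^ k i}
  let e' : M ≃ₗ[R] P := e.trans (DirectSum.linearEquivFunOnFintype R ι _)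
  refine ⟨e'.symm.conj.toLinearMap ∘ₗ LinearMap.mul R P ∘ₗ e'.toLinearMap, ?_⟩
  have hP : Function.Injective (LinearMap.mul R P) := fun a b h ↦ by
    simpa using LinearMap.congr_fun h 1
  exact e'.symm.conj.injective.comp (hP.comp e'.injective)

/-- The centralizer of an endomorphism has dimension at least that of the space. -/
theorem Module.End.finrank_le_finrank_ker_mulLeft_sub_mulRight {K W : Type*} [Field K]
    [AddCommGroup W] [Module K W] [FiniteDimensional K W] (B : Module.End K W) :
    Module.finrank K W ≤
      Module.finrank K (LinearMap.ker (LinearMap.mulLeft K B - LinearMap.mulRight K B)) := by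
  obtain ⟨m, hm⟩ := Module.exists_injective_end_of_isTorsion
    (Module.AEval.isTorsion_of_finiteDimensional K W B)
  let o := Module.AEval.of K W B
  let f : W →ₗ[K] Module.End K W :=
    { toFun v := o.symm.toLinearMap ∘ₗ (m (o v)).restrictScalars K ∘ₗ o.toLinearMap
      map_add' v w := by ext; simp
      map_smul' c v := by
        ext x
        have : m (c • o v) = c • m (o v) := (m.restrictScalars K).map_smul c (o v)
        simp [this] }
  have hf : Function.Injective f := fun v w h ↦ by
    refine o.injective (hm (LinearMap.ext fun x ↦ ?_))
    simpa [f] using LinearMap.congr_fun h (o.symm x)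
  refine LinearMap.finrank_le_finrank_of_injective
    (f := f.codRestrict (LinearMap.ker _) fun v ↦ ?_) (fun v w h ↦ hf (congrArg Subtype.val h))
  rw [LinearMap.mem_ker, LinearMap.sub_apply, sub_eq_zero]
  ext x
  have hX : m (o v) (o (B x)) = (Polynomial.X : Polynomial K) • m (o v) (o x) := by
    rw [← map_smul]
    exact congrArg _ (Module.AEval.X_smul_of B x).symm
  simp only [LinearMap.mulLeft_apply, LinearMap.mulRight_apply, Module.End.mul_apply]
  change B (o.symm (m (o v) (o x))) = o.symm (m (o v) (o (B x)))
  rw [hX]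
  exact (Module.AEval.of_symm_X_smul B _).symm

theorem finrank_quotient_range_mulRight_sub_mulLeft {K S : Type*} [Field K] [Ring S] [Algebra K S]
    [FiniteDimensional K S] (a : S) :
    Module.finrank K (S ⧸ LinearMap.range (LinearMap.mulRight K a - LinearMap.mulLeft K a)) =
      Module.finrank K (LinearMap.ker (LinearMap.mulLeft K a - LinearMap.mulRight K a)) := by
  have h := LinearMap.finrank_range_add_finrank_ker
    (LinearMap.mulRight K a - LinearMap.mulLeft K a)
  have h' := Submodule.finrank_quotient_add_finrank
    (LinearMap.range (LinearMap.mulRight K a - LinearMap.mulLeft K a))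
  rw [← neg_sub (LinearMap.mulRight K a), LinearMap.ker_neg]
  omega

/-- Block-diagonal endomorphisms whose blocks commute with the blocks of `B` commute with `B`. -/
theorem Module.End.sum_finrank_ker_le_of_isInternal {K W ι : Type*} [Field K]
    [AddCommGroup W] [Module K W] [FiniteDimensional K W] [Fintype ι] [DecidableEq ι]
    {V : ι → Submodule K W} (hV : DirectSum.IsInternal V) (B : Module.End K W)
    (hB : ∀ i, ∀ x ∈ V i, B x ∈ V i) :
    ∑ i, Module.finrank K (LinearMap.ker
        ((LinearMap.mulLeft K (B.restrict (hB i)) - LinearMap.mulRight K (B.restrict (hB i)) :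
          Module.End K (V i) →ₗ[K] Module.End K (V i)))) ≤
      Module.finrank K (LinearMap.ker (LinearMap.mulLeft K B - LinearMap.mulRight K B)) := by
  let e : (Π i, V i) ≃ₗ[K] W := (DirectSum.linearEquivFunOnFintype K ι _).symm.trans
    (LinearEquiv.ofBijective (DirectSum.coeLinearMap V) hV)
  have he_single (i : ι) (x : V i) : e (Pi.single i x) = x := by
    have : (DirectSum.linearEquivFunOnFintype K ι (fun i ↦ V i)).symm (Pi.single i x) =
        DirectSum.lof K ι (fun i ↦ V i) i x := by
      rw [LinearEquiv.symm_apply_eq, DirectSum.linearEquivFunOnFintype_lof]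
    simp only [e, LinearEquiv.trans_apply, this]
    exact DirectSum.coeLinearMap_lof V i x
  have he (v : Π i, V i) : e v = ∑ i, (v i : W) := by
    conv_lhs => rw [← Finset.univ_sum_single v]
    simp [he_single]
  have heB (v : Π i, V i) : B (e v) = e fun i ↦ B.restrict (hB i) (v i) := by
    simp [he]
  let f : (Π i, Module.End K (V i)) →ₗ[K] Module.End K W :=
    e.conj.toLinearMap ∘ₗ
      { toFun X := LinearMap.piMap X
        map_add' _ _ := rfl
        map_smul' _ _ := rfl }
  have hf_apply (X : Π i, Module.End K (V i)) (v : Π i, V i) :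
      f X (e v) = e fun i ↦ X i (v i) := by
    simp [f, LinearEquiv.conj_apply]
    rfl
  have hf : Function.Injective f := fun X Y h ↦ by
    ext i x
    have := congrFun (e.injective ((hf_apply X (Pi.single i x)).symm.trans
      ((LinearMap.congr_fun h _).trans (hf_apply Y (Pi.single i x))))) i
    simpa using congrArg Subtype.val this
  let Z (i : ι) : Submodule K (Module.End K (V i)) := LinearMap.ker
    (LinearMap.mulLeft K (B.restrict (hB i)) - LinearMap.mulRight K (B.restrict (hB i)))
  let g : (Π i, Z i) →ₗ[K] Module.End K W := f ∘ₗ LinearMap.piMap fun i ↦ (Z i).subtype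
  have hg : Function.Injective g := fun X Y h ↦ by
    funext i
    exact Subtype.ext (congrFun (hf h) i)
  have (i : ι) : Module.Free K (Z i) := Module.Free.of_divisionRing K (Z i)
  have (i : ι) : Module.Finite K (Z i) := FiniteDimensional.finiteDimensional_submodule (Z i)
  rw [← Module.finrank_pi_fintype K (M := fun i ↦ Z i)]
  refine LinearMap.finrank_le_finrank_of_injective
    (f := g.codRestrict (LinearMap.ker _) fun X ↦ ?_) (fun v w h ↦ hg (congrArg Subtype.val h))
  rw [LinearMap.mem_ker, LinearMap.sub_apply, sub_eq_zero]
  ext w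
  obtain ⟨v, rfl⟩ := e.surjective w
  simp only [LinearMap.mulLeft_apply, LinearMap.mulRight_apply, Module.End.mul_apply]
  simp only [g, LinearMap.comp_apply, hf_apply, heB]
  congr 1
  funext i
  have hX := (X i).2
  rw [LinearMap.mem_ker, LinearMap.sub_apply, sub_eq_zero] at hX
  exact LinearMap.congr_fun hX (v i)

theorem Matrix.finrank_ker_mulLeft_sub_mulRight {K m : Type*} [Field K] [Fintype m] [DecidableEq m]
    (A : Matrix m m K) :
    Module.finrank K (LinearMap.ker
        (LinearMap.mulLeft K A.mulVecLin - LinearMap.mulRight K A.mulVecLin :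
          Module.End K (m → K) →ₗ[K] Module.End K (m → K))) =
      Module.finrank K (LinearMap.ker (LinearMap.mulLeft K A - LinearMap.mulRight K A)) := by
  have hA : A.mulVecLin = Matrix.toLinAlgEquiv' A := rfl
  refine (LinearEquiv.finrank_eq
    ((Matrix.toLinAlgEquiv' (R := K) (n := m)).toLinearEquiv.ofSubmodules _ _ ?_)).symm
  ext X
  obtain ⟨Y, rfl⟩ := (Matrix.toLinAlgEquiv' (R := K) (n := m)).surjective X
  simp [hA, sub_eq_zero, ← map_mul]


open Matrix

set_option maxSynthPendingDepth 2
set_option synthInstance.maxHeartbeats 1000000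
set_option maxHeartbeats 1000000

/-- Let `F` be a finite field, `A ∈ GL_n(F)` regular (centralizer of
dimension `n`), and suppose `F^n`, as an `F[A]`-module, decomposes as an internal
direct sum of `A`-invariant submodules `V i`.  Then `M_n(F)/[M_n(F), A]` decomposes
as the direct sum of the spaces `End(V i)/[End(V i), A|_{V i}]`, where `[E, A]`
denotes the image of `X ↦ X·A − A·X`. -/
theorem ad_quotient_decomposition
    (F : Type*) [Field F] [Fintype F] (n : ℕ) (hn : 0 < n)
    (A : Matrix (Fin n) (Fin n) F) (hA : IsUnit A)
    (hreg : Module.finrank F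
      (LinearMap.ker (LinearMap.mulLeft F A - LinearMap.mulRight F A)) = n)
    (ι : Type*) [Fintype ι] [DecidableEq ι] (V : ι → Submodule F (Fin n → F))
    (hinv : ∀ i, ∀ x ∈ V i, A.mulVecLin x ∈ V i)
    (hdec : DirectSum.IsInternal V) :
    Nonempty
      ((Matrix (Fin n) (Fin n) F ⧸
          LinearMap.range (LinearMap.mulRight F A - LinearMap.mulLeft F A))
        ≃ₗ[F]
       Π i : ι, (Module.End F (V i) ⧸
          LinearMap.range
            ((LinearMap.mulRight F (A.mulVecLin.restrict (hinv i)) -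
              LinearMap.mulLeft F (A.mulVecLin.restrict (hinv i)) :
              Module.End F (V i) →ₗ[F] Module.End F (V i))))) := by
  refine ⟨LinearEquiv.ofFinrankEq _ _ ?_⟩
  rw [Module.finrank_pi_fintype, finrank_quotient_range_mulRight_sub_mulLeft, hreg]
  simp_rw [finrank_quotient_range_mulRight_sub_mulLeft]
  apply le_antisymm
  · calc n = Module.finrank F (Fin n → F) := by simp
      _ = ∑ i, Module.finrank F (V i) := by
        rw [← (LinearEquiv.ofBijective (DirectSum.coeLinearMap V) hdec).finrank_eq,
          Module.finrank_directSum]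
      _ ≤ _ := Finset.sum_le_sum fun i _ ↦
        Module.End.finrank_le_finrank_ker_mulLeft_sub_mulRight _
  · calc _ ≤ _ := Module.End.sum_finrank_ker_le_of_isInternal hdec A.mulVecLin hinv
      _ = n := by rw [Matrix.finrank_ker_mulLeft_sub_mulRight, hreg]
end

section
/- Let F be a finite field of characteristic ℓ and W(F) its ring of Witt vectors. Every matrix B̄ ∈ GL_n(F) admits a 'minimal lift' B ∈ GL_n(W(F)): that is, the W(F)[X]-module V = W(F)^n on which X acts via B decomposes as V = ⊕_i V_{i,s} ⊗_{W(F)} V_{i,u}, where on each V_{i,u} the action of X is W(F)-conjugate to a single regular unipotent Jordan block, on each V_{i,s} the characteristic polynomial of X is irreducible with roots that are Teichmüller lifts of elements of the algebraic closure of F, and B reduces to B̄ modulo the maximal ideal of W(F). -/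
open Matrix

/-- A single (regular unipotent) Jordan block of size `m` with eigenvalue `1`. -/
def jordanBlockOne (R : Type*) [CommRing R] (m : ℕ) : Matrix (Fin m) (Fin m) R :=
  Matrix.of fun i j => if (i : ℕ) = j ∨ (i : ℕ) + 1 = j then 1 else 0

/-- `B ∈ M_n(W(F))` is a *minimal lift* of `B̄ ∈ M_n(F)`: it reduces to `B̄` and the
module `W(F)^n` with `X` acting by `B` decomposes as `⊕ᵢ V_{i,s} ⊗ V_{i,u}`, where on
`V_{i,u}` the matrix of `X` is a regular unipotent Jordan block and on `V_{i,s}` the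
characteristic polynomial of `X` is irreducible with Teichmüller roots (equivalently
the semisimple factors have finite order prime to `ℓ`). -/
def IsMinimalLift (ℓ : ℕ) [Fact ℓ.Prime] (F : Type*) [Field F] [CharP F ℓ] (n : ℕ)
    (B : Matrix (Fin n) (Fin n) (WittVector ℓ F))
    (Bbar : Matrix (Fin n) (Fin n) F) : Prop :=
  B.map (WittVector.ghostComponent 0) = Bbar ∧
  ∃ (k : ℕ) (d e : Fin k → ℕ)
    (C : ∀ i : Fin k, Matrix (Fin (d i)) (Fin (d i)) (WittVector ℓ F))
    (eqv : (Σ i : Fin k, Fin (d i) × Fin (e i)) ≃ Fin n)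
    (P : Matrix (Fin n) (Fin n) (WittVector ℓ F)),
      (∀ i, Irreducible (C i).charpoly) ∧
      (∀ i, ∃ N : ℕ, 0 < N ∧ ¬ ℓ ∣ N ∧ (C i) ^ N = 1) ∧
      IsUnit P ∧
      B * P = P * (Matrix.reindex eqv eqv (Matrix.blockDiagonal'
        fun i => Matrix.kroneckerMap (· * ·) (C i) (jordanBlockOne (WittVector ℓ F) (e i))))

section

open Polynomial

theorem exists_pow_one_add_natCast_mul {R : Type*} [Ring R] (p : ℕ) (M : R) {j k : ℕ}
    (hkj : k ≤ j) (s : ℕ) :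
    ∃ M' : R, (1 + (p : R) * M) ^ (p ^ j * s) = 1 + (p : R) ^ k * M' := by
  have h1 : ((p : ℤ[X]) ∣ (1 + (p : ℤ[X]) * X) - 1) := ⟨X, by ring⟩
  have h2 := (dvd_sub_pow_of_dvd_sub h1 j).trans (sub_dvd_pow_sub_pow _ _ s)
  obtain ⟨Q, hQ⟩ := (pow_dvd_pow (p : ℤ[X]) (show k ≤ j + 1 by omega)).trans h2
  refine ⟨aeval M Q, ?_⟩
  have h3 := congrArg (aeval M) hQ
  simp only [one_pow, ← pow_mul, map_sub, map_pow, map_add, map_mul, map_one, map_natCast,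
    aeval_X] at h3
  rw [← h3]; abel

theorem WittVector.ghostComponent_zero_eq_coeff
    {ℓ : ℕ} [Fact ℓ.Prime] {F : Type*} [Field F]
    (x : WittVector ℓ F) :
    WittVector.ghostComponent 0 x = x.coeff 0 := by
  simp [WittVector.ghostComponent_apply, wittPolynomial_zero]

theorem WittVector.ghostComponent_zero_surjective
    {ℓ : ℕ} [Fact ℓ.Prime] {F : Type*} [Field F] :
    Function.Surjective (WittVector.ghostComponent 0 : WittVector ℓ F →+* F) := fun x =>
  ⟨WittVector.teichmuller ℓ x, by simp⟩

theorem WittVector.natCast_dvd_of_ghostComponent_zero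
    {ℓ : ℕ} [Fact ℓ.Prime] {F : Type*} [Field F] [Fintype F] [CharP F ℓ]
    {x : WittVector ℓ F}
    (hx : WittVector.ghostComponent 0 x = 0) : (ℓ : WittVector ℓ F) ∣ x := by
  rw [← Ideal.mem_span_singleton, WittVector.mem_span_p_iff_coeff_zero_eq_zero,
    ← WittVector.ghostComponent_zero_eq_coeff, hx]

theorem WittVector.isUnit_of_isUnit_ghostComponent_zero
    {ℓ : ℕ} [Fact ℓ.Prime] {F : Type*} [Field F] [CharP F ℓ]
    {x : WittVector ℓ F}
    (hx : IsUnit (WittVector.ghostComponent 0 x)) : IsUnit x :=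
  WittVector.isUnit_of_coeff_zero_ne_zero x
    (by rw [← WittVector.ghostComponent_zero_eq_coeff]; exact hx.ne_zero)

theorem Matrix.natCast_mul_apply {R ι : Type*} [CommRing R] [Fintype ι] [DecidableEq ι]
    (m : ℕ) (M : Matrix ι ι R) (i j : ι) : ((m : Matrix ι ι R) * M) i j = m * M i j := by
  rw [← nsmul_eq_mul, Matrix.smul_apply, nsmul_eq_mul]

theorem Matrix.exists_natCast_mul_of_map_eq_zero
    {ℓ : ℕ} [Fact ℓ.Prime] {F : Type*} [Field F] [Fintype F] [CharP F ℓ]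
    {ι : Type*} [Fintype ι] [DecidableEq ι]
    (M : Matrix ι ι (WittVector ℓ F))
    (hM : (WittVector.ghostComponent 0).mapMatrix M = (0 : Matrix ι ι F)) :
    ∃ M' : Matrix ι ι (WittVector ℓ F), M = (ℓ : Matrix ι ι (WittVector ℓ F)) * M' := by
  have h : ∀ i j, ∃ y, M i j = ℓ * y := fun i j =>
    WittVector.natCast_dvd_of_ghostComponent_zero (congrFun (congrFun hM i) j)
  choose y hy using h
  refine ⟨Matrix.of y, ?_⟩
  ext1 i j
  rw [Matrix.natCast_mul_apply, hy, Matrix.of_apply]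

theorem Matrix.exists_lift
    {ℓ : ℕ} [Fact ℓ.Prime] {F : Type*} [Field F]
    {m n : Type*} (M : Matrix m n F) :
    ∃ A : Matrix m n (WittVector ℓ F), A.map (WittVector.ghostComponent 0) = M := by
  choose g hg using WittVector.ghostComponent_zero_surjective (ℓ := ℓ) (F := F)
  exact ⟨M.map g, by ext; simp [hg]⟩

theorem Matrix.isUnit_of_isUnit_map
    {ℓ : ℕ} [Fact ℓ.Prime] {F : Type*} [Field F] [CharP F ℓ]
    {ι : Type*} [Fintype ι] [DecidableEq ι]
    {A : Matrix ι ι (WittVector ℓ F)}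
    (hA : IsUnit (A.map (WittVector.ghostComponent 0 : WittVector ℓ F →+* F))) : IsUnit A := by
  rw [Matrix.isUnit_iff_isUnit_det] at hA ⊢
  apply WittVector.isUnit_of_isUnit_ghostComponent_zero
  rwa [RingHom.map_det]

/-- A matrix of finite order prime to `ℓ` lifts to a matrix over the Witt vectors of the
same order: take the limit of the `ℓ ^ (φ N * k)`-th powers of an arbitrary lift. -/
theorem Matrix.exists_lift_pow_eq_one
    {ℓ : ℕ} [Fact ℓ.Prime] {F : Type*} [Field F] [Fintype F] [CharP F ℓ]
    {ι : Type*} [Fintype ι] [DecidableEq ι]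
    (M : Matrix ι ι F) {N : ℕ} (hℓN : ¬ ℓ ∣ N) (hM : M ^ N = 1) :
    ∃ C : Matrix ι ι (WittVector ℓ F),
      C.map (WittVector.ghostComponent 0) = M ∧ C ^ N = 1 := by
  have hℓ : ℓ.Prime := Fact.out
  have hN : N ≠ 0 := by rintro rfl; exact hℓN (dvd_zero _)
  let ρ := (WittVector.ghostComponent 0 : WittVector ℓ F →+* F).mapMatrix (m := ι)
  obtain ⟨A, hA⟩ := Matrix.exists_lift (ℓ := ℓ) M
  replace hA : ρ A = M := hA
  obtain ⟨A', hA'⟩ : ∃ A', A ^ N - 1 = (ℓ : Matrix ι ι (WittVector ℓ F)) * A' := by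
    apply Matrix.exists_natCast_mul_of_map_eq_zero
    change ρ _ = 0
    rw [map_sub, map_pow, hA, hM, map_one, sub_self]
  replace hA' : A ^ N = 1 + (ℓ : Matrix ι ι (WittVector ℓ F)) * A' := by rw [← hA']; abel
  set t := N.totient
  have ht : 0 < t := Nat.totient_pos.2 (Nat.pos_of_ne_zero hN)
  have hmod : ∀ k, ℓ ^ (t * k) ≡ 1 [MOD N] := fun k => by
    have := (Nat.ModEq.pow_totient ((Nat.Prime.coprime_iff_not_dvd hℓ).2 hℓN)).pow k
    rwa [one_pow, ← pow_mul] at this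
  have hdvd : ∀ k, N ∣ ℓ ^ (t * k) - 1 := fun k =>
    (Nat.modEq_iff_dvd' (Nat.one_le_pow _ _ hℓ.pos)).1 (hmod k).symm
  let π : ∀ k : ℕ, Matrix ι ι (WittVector ℓ F) →+*
      Matrix ι ι (WittVector ℓ F ⧸ (Ideal.span {(ℓ : WittVector ℓ F)}) ^ k) := fun k =>
    (Ideal.Quotient.mk _).mapMatrix
  have hπℓ : ∀ k, π k ((ℓ : Matrix ι ι (WittVector ℓ F)) ^ k) = 0 := fun k => by
    ext1 i j
    have h : ((ℓ : Matrix ι ι (WittVector ℓ F)) ^ k : Matrix ι ι (WittVector ℓ F)) i j =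
        ((ℓ ^ k : ℕ) : WittVector ℓ F) * (1 : Matrix ι ι (WittVector ℓ F)) i j := by
      rw [← Matrix.natCast_mul_apply, mul_one, Nat.cast_pow]
    change Ideal.Quotient.mk _ (((ℓ : Matrix ι ι (WittVector ℓ F)) ^ k :
      Matrix ι ι (WittVector ℓ F)) i j) = 0
    rw [Ideal.Quotient.eq_zero_iff_mem, Ideal.span_singleton_pow, Ideal.mem_span_singleton, h,
      Nat.cast_pow]
    exact dvd_mul_right _ _
  have hπA : ∀ k j s, k ≤ j → π k (A ^ (N * (ℓ ^ j * s))) = 1 := fun k j s hkj => by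
    obtain ⟨M', hM'⟩ := exists_pow_one_add_natCast_mul ℓ A' hkj s
    rw [pow_mul, hA', hM', map_add, map_mul, hπℓ, zero_mul, add_zero, map_one]
  have hkt : ∀ k, k ≤ t * k := fun k => Nat.le_mul_of_pos_left k ht
  have hcauchy : ∀ a b, a ≤ b → π a (A ^ ℓ ^ (t * a)) = π a (A ^ ℓ ^ (t * b)) := by
    intro a b hab
    obtain ⟨c, rfl⟩ := Nat.exists_eq_add_of_le hab
    obtain ⟨s, hs⟩ := hdvd c
    have h1 : 1 ≤ ℓ ^ (t * c) := Nat.one_le_pow _ _ hℓ.pos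
    have : ℓ ^ (t * (a + c)) = ℓ ^ (t * a) + N * (ℓ ^ (t * a) * s) := by
      rw [mul_add, pow_add, show ℓ ^ (t * c) = 1 + N * s by omega]; ring
    rw [this, pow_add, map_mul, hπA a _ s (hkt a), mul_one]
  have hlim : ∀ i j, ∃ L : WittVector ℓ F, ∀ k, (A ^ ℓ ^ (t * k)) i j ≡ L
      [SMOD ((Ideal.span {(ℓ : WittVector ℓ F)}) ^ k • ⊤ :
        Submodule (WittVector ℓ F) (WittVector ℓ F))] := fun i j => by
    refine IsPrecomplete.prec' (fun k => (A ^ ℓ ^ (t * k)) i j) fun {a b} hab => ?_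
    rw [SModEq.sub_mem, smul_eq_mul, Ideal.mul_top, ← Ideal.Quotient.mk_eq_mk_iff_sub_mem]
    exact congrFun (congrFun (hcauchy a b hab) i) j
  choose L hL using hlim
  have hπL : ∀ k, π k (A ^ ℓ ^ (t * k)) = π k (Matrix.of L) := fun k => by
    ext1 i j
    have := hL i j k
    rw [SModEq.sub_mem, smul_eq_mul, Ideal.mul_top, ← Ideal.Quotient.mk_eq_mk_iff_sub_mem] at this
    exact this
  refine ⟨Matrix.of L, ?_, ?_⟩
  · have hA1 : ρ (A ^ ℓ ^ (t * 1)) = M := by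
      have h1 : 1 ≤ ℓ ^ (t * 1) := Nat.one_le_pow _ _ hℓ.pos
      obtain ⟨s, hs⟩ := hdvd 1
      rw [map_pow, hA, show ℓ ^ (t * 1) = 1 + N * s by omega, pow_add, pow_mul, hM, one_pow,
        pow_one, mul_one]
    rw [← hA1]
    ext1 i j
    have := hL i j 1
    rw [SModEq.sub_mem, smul_eq_mul, Ideal.mul_top, pow_one,
      WittVector.mem_span_p_iff_coeff_zero_eq_zero, ← WittVector.ghostComponent_zero_eq_coeff,
      map_sub, sub_eq_zero] at this
    exact this.symm
  · ext1 i j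
    rw [← sub_eq_zero]
    refine IsHausdorff.haus (I := Ideal.span {(ℓ : WittVector ℓ F)}) inferInstance _ fun k => ?_
    rw [SModEq.sub_mem, smul_eq_mul, Ideal.mul_top, sub_zero,
      ← Ideal.Quotient.mk_eq_mk_iff_sub_mem]
    have : π k (Matrix.of L ^ N) = π k 1 := by
      rw [map_pow, ← hπL, ← map_pow, ← pow_mul, mul_comm, ← mul_one (ℓ ^ _),
        hπA k _ 1 (hkt k), map_one]
    exact congrFun (congrFun this i) j


/-- The basis `y ^ (e - 1), …, y, 1` of `R[y] / (y ^ e)`, in which multiplication by `1 + y` is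
a Jordan block. -/
theorem exists_basis_one_add_root_mul (R : Type*) [CommRing R] [Nontrivial R] (e : ℕ) :
    ∃ c : Module.Basis (Fin e) R (AdjoinRoot (X ^ e : R[X])), ∀ j,
      (1 + AdjoinRoot.root (X ^ e : R[X])) * c j = ∑ i, jordanBlockOne R e i j • c i := by
  set y := AdjoinRoot.root (X ^ e : R[X]) with hydef
  have hy : y ^ e = 0 := by
    rw [hydef, ← AdjoinRoot.mk_X, ← map_pow, AdjoinRoot.mk_self]
  let pb := AdjoinRoot.powerBasis' (monic_X_pow (R := R) e)
  have hdim : pb.dim = e := by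
    simp [pb, AdjoinRoot.powerBasis'_dim]
  let c := (pb.basis.reindex (finCongr hdim)).reindex Fin.revPerm
  have hc : ∀ j, c j = y ^ (e - 1 - j : ℕ) := fun j => by
    simp only [c, Module.Basis.reindex_apply, PowerBasis.basis_eq_pow]
    simp only [pb, AdjoinRoot.powerBasis'_gen, Fin.revPerm_symm, Fin.revPerm_apply, finCongr_symm,
      finCongr_apply, Fin.val_cast, Fin.val_rev]
    congr 1
    omega
  refine ⟨c, fun j => ?_⟩
  have hJ : ∀ i, jordanBlockOne R e i j • c i =
      (if i = j then c i else 0) + if (i : ℕ) + 1 = j then c i else 0 := fun i => by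
    simp only [jordanBlockOne, Matrix.of_apply, Fin.ext_iff]
    split_ifs <;> first | omega | simp
  rw [Finset.sum_congr rfl fun i _ => hJ i, Finset.sum_add_distrib, Finset.sum_ite_eq',
    if_pos (Finset.mem_univ _), add_mul, one_mul, add_right_inj, hc, ← pow_succ']
  rcases Nat.eq_zero_or_pos (j : ℕ) with h0 | h0
  · rw [Finset.sum_eq_zero fun i _ => if_neg (by omega), h0,
      show e - 1 - 0 + 1 = e by have := j.2; omega, hy]
  · have hj := j.2
    rw [Finset.sum_eq_single (⟨j - 1, by omega⟩ : Fin e), if_pos (by simp; omega), hc]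
    · congr 1
      simp only
      omega
    · intro i _ hi
      rw [if_neg]
      intro h
      exact hi (Fin.ext (by simp; omega))
    · simp

/-- Let `α ≠ 0` be a simple root of the irreducible polynomial `p`, generating an extension with
basis `b`. Then `F[X] / (p ^ e)` is isomorphic to `F(α)[y] / (y ^ e)` via `X ↦ α (1 + y)`. -/
theorem exists_basis_quotient_pow {F K : Type*} [Field F] [Field K] [Algebra F K] {p : F[X]}
    (hp : Irreducible p) (b : Module.Basis (Fin p.natDegree) F K) {α : K} (h0 : α ≠ 0)
    (hα : aeval α p = 0) (hα' : aeval α (derivative p) ≠ 0) (e : ℕ) :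
    ∃ β : Module.Basis (Fin p.natDegree × Fin e) F (F[X] ⧸ Ideal.span {p ^ e}), ∀ q,
      (X : F[X]) • β q = ∑ r, Matrix.kroneckerMap (· * ·) (Algebra.leftMulMatrix b α)
        (jordanBlockOne F e) r q • β r := by
  obtain ⟨c, hc⟩ := exists_basis_one_add_root_mul K e
  set y := AdjoinRoot.root (X ^ e : K[X]) with hydef
  have hy : y ^ e = 0 := by
    rw [hydef, ← AdjoinRoot.mk_X, ← map_pow, AdjoinRoot.mk_self]
  have hym : ∀ m, y ^ m = 0 → e ≤ m := fun m hm => by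
    rw [hydef, ← AdjoinRoot.mk_X, ← map_pow, AdjoinRoot.mk_eq_zero] at hm
    exact (pow_dvd_pow_iff X_ne_zero not_isUnit_X).1 hm
  set a := algebraMap K (AdjoinRoot (X ^ e : K[X])) α with ha
  set x := a + a * y with hx
  obtain ⟨u, hu, hpx⟩ : ∃ u, IsUnit u ∧ aeval x p = y * u := by
    obtain ⟨k, hk⟩ := binomExpansion (p.map (algebraMap F (AdjoinRoot (X ^ e : K[X])))) a (a * y)
    rw [derivative_map, eval_map_algebraMap, eval_map_algebraMap, eval_map_algebraMap, ha,
      aeval_algebraMap_apply, aeval_algebraMap_apply, hα, map_zero, zero_add, ← ha, ← hx] at hk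
    refine ⟨k * a ^ 2 * y + algebraMap K _ (aeval α (derivative p)) * a, ?_, by rw [hk]; ring⟩
    refine IsNilpotent.isUnit_add_right_of_commute ⟨e, ?_⟩ ?_ (Commute.all _ _)
    · rw [mul_pow, hy, mul_zero]
    · rw [ha, ← map_mul]
      exact (IsUnit.mk0 _ (mul_ne_zero hα' h0)).map _
  have hker : ∀ f : F[X], aeval x f = 0 ↔ p ^ e ∣ f := fun f => by
    constructor
    · intro hf
      let I := RingHom.ker (aeval x : F[X] →ₐ[F] AdjoinRoot (X ^ e : K[X]))
      obtain ⟨g, hg⟩ := IsPrincipalIdealRing.principal I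
      have hmem : ∀ f, g ∣ f ↔ aeval x f = 0 := fun f => by
        rw [← Ideal.mem_span_singleton, Ideal.span, ← hg, RingHom.mem_ker]
      have h1 : g ∣ p ^ e := by rw [hmem, map_pow, hpx, mul_pow, hy, zero_mul]
      obtain ⟨m, -, hm⟩ := (dvd_prime_pow hp.prime e).1 h1
      have h2 := (hmem _).1 hm.dvd
      rw [map_pow, hpx, mul_pow, (hu.pow m).mul_left_eq_zero] at h2
      exact (pow_dvd_pow p (hym m h2)).trans (hm.symm.dvd.trans ((hmem f).2 hf))
    · rintro ⟨g, rfl⟩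
      rw [map_mul, map_pow, hpx, mul_pow, hy, zero_mul, zero_mul]
  let ψ : (F[X] ⧸ Ideal.span {p ^ e}) →ₐ[F] AdjoinRoot (X ^ e : K[X]) :=
    Ideal.Quotient.liftₐ _ (aeval x) fun f hf => (hker f).2 (Ideal.mem_span_singleton.1 hf)
  have hψ : ∀ f, ψ (Ideal.Quotient.mk _ f) = aeval x f := fun f => rfl
  have hψinj : Function.Injective ψ := by
    rw [injective_iff_map_eq_zero]
    intro v
    obtain ⟨f, rfl⟩ := Ideal.Quotient.mk_surjective v
    rw [hψ, hker, Ideal.Quotient.eq_zero_iff_mem, Ideal.mem_span_singleton]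
    exact id
  let B := b.smulTower c
  have hfin : Module.Finite F (AdjoinRoot (X ^ e : K[X])) := Module.Finite.of_basis B
  have hdim : Module.finrank F (F[X] ⧸ Ideal.span {p ^ e}) =
      Module.finrank F (AdjoinRoot (X ^ e : K[X])) := by
    rw [finrank_quotient_span_eq_natDegree, Module.finrank_eq_card_basis B, natDegree_pow]
    simp [mul_comm]
  let Ψ := LinearEquiv.ofInjectiveOfFinrankEq ψ.toLinearMap hψinj hdim
  have hΨ : ∀ v, Ψ v = ψ v := fun v => rfl
  refine ⟨B.map Ψ.symm, fun q => Ψ.injective ?_⟩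
  have hX : ∀ v, Ψ ((X : F[X]) • v) = x * Ψ v := fun v => by
    obtain ⟨f, rfl⟩ := Ideal.Quotient.mk_surjective v
    change aeval x (X * f) = x * aeval x f
    rw [map_mul, aeval_X]
  have hαb : α * b q.1 = ∑ i, Algebra.leftMulMatrix b α i q.1 • b i := by
    simp_rw [Algebra.leftMulMatrix_eq_repr_mul, b.sum_repr]
  simp only [hX, map_sum, map_smul, Module.Basis.map_apply, LinearEquiv.apply_symm_apply, B,
    Module.Basis.smulTower_apply]
  have : x * (b q.1 • c q.2) = (α * b q.1) • ((1 + y) * c q.2) := by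
    rw [hx, ha, Algebra.smul_def, Algebra.smul_def, map_mul]; ring
  rw [this, hc, hαb, Finset.sum_smul_sum, Fintype.sum_prod_type]
  refine Finset.sum_congr rfl fun i _ => Finset.sum_congr rfl fun j _ => ?_
  simp only [Matrix.kroneckerMap_apply, jordanBlockOne, Matrix.of_apply]
  split_ifs <;> simp

/-- Over a finite field, `F[X] / (p ^ e)` has a basis in which `X` acts through the tensor
product of a matrix of finite order prime to the characteristic with a Jordan block. -/
theorem exists_basis_quotient_pow_of_finite {F : Type*} [Field F] [Fintype F] (ℓ : ℕ)
    [Fact ℓ.Prime] [CharP F ℓ] {p : F[X]} (hp : Irreducible p) (hpX : ¬ p ∣ X) (e : ℕ) :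
    ∃ (d : ℕ) (M : Matrix (Fin d) (Fin d) F)
      (β : Module.Basis (Fin d × Fin e) F (F[X] ⧸ Ideal.span {p ^ e})),
      Irreducible M.charpoly ∧ (∃ N : ℕ, 0 < N ∧ ¬ ℓ ∣ N ∧ M ^ N = 1) ∧
      ∀ q, (X : F[X]) • β q =
        ∑ r, Matrix.kroneckerMap (· * ·) M (jordanBlockOne F e) r q • β r := by
  have : Fact (Irreducible p) := ⟨hp⟩
  let pb := AdjoinRoot.powerBasis hp.ne_zero
  let b : Module.Basis (Fin p.natDegree) F (AdjoinRoot p) := pb.basis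
  let α := AdjoinRoot.root p
  have h0 : α ≠ 0 := fun h => hpX (AdjoinRoot.mk_eq_zero.1 ((AdjoinRoot.mk_X).trans h))
  have hα : aeval α p = 0 := by rw [AdjoinRoot.aeval_eq, AdjoinRoot.mk_self]
  have hα' : aeval α (derivative p) ≠ 0 :=
    (PerfectField.separable_of_irreducible hp).aeval_derivative_ne_zero hα
  obtain ⟨β, hβ⟩ := exists_basis_quotient_pow hp b h0 hα hα' e
  refine ⟨p.natDegree, Algebra.leftMulMatrix b α, β, ?_, ?_, hβ⟩
  · have : (Algebra.leftMulMatrix b α).charpoly = minpoly F α := charpoly_leftMulMatrix pb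
    rw [this]
    exact minpoly.irreducible ((AdjoinRoot.isIntegral_root hp.ne_zero))
  · have : Module.Finite F (AdjoinRoot p) := Module.Finite.of_basis b
    have : Finite (AdjoinRoot p) := Module.finite_of_finite F
    have : Fintype (AdjoinRoot p) := Fintype.ofFinite _
    have : CharP (AdjoinRoot p) ℓ := charP_of_injective_algebraMap (algebraMap F _).injective ℓ
    have hcard : 1 < Fintype.card (AdjoinRoot p) := Fintype.one_lt_card
    refine ⟨Fintype.card (AdjoinRoot p) - 1, by omega, fun h => ?_, ?_⟩
    · have h1 : ((Fintype.card (AdjoinRoot p) - 1 : ℕ) : AdjoinRoot p) = 0 :=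
        (CharP.cast_eq_zero_iff _ ℓ _).2 h
      rw [Nat.cast_sub hcard.le, FiniteField.cast_card_eq_zero] at h1
      simp at h1
    · rw [← map_pow, FiniteField.pow_card_sub_one_eq_one α h0, map_one]

/-- The matrix `Bbar` is conjugate to a block diagonal matrix of tensor products of matrices of
finite order prime to the characteristic with Jordan blocks. -/
theorem exists_conj_blockDiagonal {F : Type*} [Field F] [Fintype F] (ℓ : ℕ) [Fact ℓ.Prime]
    [CharP F ℓ] (n : ℕ) (Bbar : Matrix (Fin n) (Fin n) F) (hBbar : IsUnit Bbar) :
    ∃ (k : ℕ) (d e : Fin k → ℕ) (M : ∀ i : Fin k, Matrix (Fin (d i)) (Fin (d i)) F)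
      (eqv : (Σ i : Fin k, Fin (d i) × Fin (e i)) ≃ Fin n) (P : Matrix (Fin n) (Fin n) F),
      (∀ i, Irreducible (M i).charpoly) ∧
      (∀ i, ∃ N : ℕ, 0 < N ∧ ¬ ℓ ∣ N ∧ (M i) ^ N = 1) ∧
      IsUnit P ∧
      Bbar * P = P * (Matrix.reindex eqv eqv (Matrix.blockDiagonal'
        fun i => Matrix.kroneckerMap (· * ·) (M i) (jordanBlockOne F (e i)))) := by
  let T := Matrix.toLin' Bbar
  have hTinj : Function.Injective T := Matrix.mulVec_injective_of_isUnit hBbar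
  have htors : Module.IsTorsion F[X] (Module.AEval' T) :=
    Module.AEval.isTorsion_of_finiteDimensional F (Fin n → F) T
  obtain ⟨ι, _, p, hp, e, ⟨l⟩⟩ := Module.equiv_directSum_of_isTorsion htors
  classical
  let L₁ := l.trans (DirectSum.linearEquivFunOnFintype F[X] ι fun i => F[X] ⧸ F[X] ∙ p i ^ e i)
  let σ := (Fintype.equivFin ι).symm
  let L := L₁.trans (LinearEquiv.piCongrLeft F[X] (fun i => F[X] ⧸ F[X] ∙ p i ^ e i) σ).symm
  have hXinj : ∀ v : (∀ j, F[X] ⧸ F[X] ∙ p (σ j) ^ e (σ j)), (X : F[X]) • v = 0 → v = 0 := by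
    intro v hv
    obtain ⟨w, rfl⟩ := L.surjective v
    obtain ⟨w, rfl⟩ := (Module.AEval'.of T).surjective w
    rw [← map_smul, Module.AEval'.X_smul_of, LinearEquiv.map_eq_zero_iff,
      LinearEquiv.map_eq_zero_iff] at hv
    rw [hTinj (hv.trans (map_zero T).symm), map_zero, map_zero]
  have hblock : ∀ j, ∃ (d : ℕ) (M : Matrix (Fin d) (Fin d) F)
      (β : Module.Basis (Fin d × Fin (e (σ j))) F (F[X] ⧸ F[X] ∙ p (σ j) ^ e (σ j))),
      Irreducible M.charpoly ∧ (∃ N : ℕ, 0 < N ∧ ¬ ℓ ∣ N ∧ M ^ N = 1) ∧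
      ∀ q, (X : F[X]) • β q =
        ∑ r, Matrix.kroneckerMap (· * ·) M (jordanBlockOne F (e (σ j))) r q • β r := fun j => by
    rcases Nat.eq_zero_or_pos (e (σ j)) with he | he
    · have hirr : Irreducible (X - C 1 : F[X]) := irreducible_X_sub_C 1
      have hndvd : ¬ (X - C 1 : F[X]) ∣ X := by
        rw [dvd_iff_isRoot]; simp
      have := exists_basis_quotient_pow_of_finite ℓ hirr hndvd (e (σ j))
      rwa [show (X - C 1 : F[X]) ^ e (σ j) = p (σ j) ^ e (σ j) by rw [he, pow_zero, pow_zero]]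
        at this
    · refine exists_basis_quotient_pow_of_finite ℓ (hp _) (fun hdvd => ?_) _
      obtain ⟨m, hm⟩ := Nat.exists_eq_add_of_le' he
      have h1 := congrFun (hXinj (Pi.single j (Submodule.Quotient.mk (p (σ j) ^ m))) ?_) j
      · rw [Pi.single_eq_same, Pi.zero_apply, Submodule.Quotient.mk_eq_zero,
          Ideal.submodule_span_eq, Ideal.mem_span_singleton, hm,
          pow_dvd_pow_iff (hp _).ne_zero (hp _).not_isUnit] at h1
        omega
      · rw [← Pi.single_smul, ← Submodule.Quotient.mk_smul, Pi.single_eq_zero_iff,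
          Submodule.Quotient.mk_eq_zero, Ideal.submodule_span_eq, Ideal.mem_span_singleton, hm,
          pow_succ', smul_eq_mul]
        exact mul_dvd_mul_right hdvd _
  choose d M β hirr hord hβ using hblock
  let Λ : (Fin n → F) ≃ₗ[F] (∀ j, F[X] ⧸ F[X] ∙ p (σ j) ^ e (σ j)) :=
    (Module.AEval'.of T).trans (L.restrictScalars F)
  have hΛ : ∀ v, Λ (T v) = (X : F[X]) • Λ v := fun v => by
    change L (Module.AEval'.of T (T v)) = (X : F[X]) • L (Module.AEval'.of T v)
    rw [← map_smul, Module.AEval'.X_smul_of]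
  let γ := (Pi.basis β).map Λ.symm
  let eqv := γ.indexEquiv (Pi.basisFun F (Fin n))
  let P := (Pi.basisFun F (Fin n)).toMatrix (γ.reindex eqv)
  have hP : IsUnit P := by
    have := (Pi.basisFun F (Fin n)).invertibleToMatrix (γ.reindex eqv)
    exact isUnit_of_invertible P
  refine ⟨_, d, fun j => e (σ j), M, eqv, P, hirr, hord, hP, ?_⟩
  have hγ : ∀ s, T (γ s) = ∑ r, Matrix.blockDiagonal' (fun j => Matrix.kroneckerMap (· * ·) (M j)
      (jordanBlockOne F (e (σ j)))) r s • γ r := by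
    rintro ⟨j, q⟩
    apply Λ.injective
    simp only [γ, hΛ, Module.Basis.map_apply, LinearEquiv.apply_symm_apply, map_sum, map_smul,
      Pi.basis_apply]
    rw [← Pi.single_smul, hβ, Fintype.sum_sigma, Finset.sum_eq_single j]
    · simp only [Matrix.blockDiagonal'_apply_eq, ← Pi.single_smul]
      exact map_sum (AddMonoidHom.single _ j) _ _
    · intro i _ hij
      exact Finset.sum_eq_zero fun r _ => by
        rw [Matrix.blockDiagonal'_apply_ne _ _ _ hij]
        exact zero_smul F (_ : ∀ j, F[X] ⧸ F[X] ∙ p (σ j) ^ e (σ j))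
    · simp
  ext i s
  have := congrFun (hγ (eqv.symm s)) i
  rw [Finset.sum_apply] at this
  have hPγ : ∀ i s, P i s = γ (eqv.symm s) i := fun i s => by
    simp [P, Module.Basis.toMatrix_apply]
  rw [Matrix.mul_apply, Matrix.mul_apply, ← Equiv.sum_comp eqv fun j => P i j * _]
  simp only [hPγ, Matrix.reindex_apply, Matrix.submatrix_apply, Equiv.symm_apply_apply]
  refine Eq.trans ?_ (this.trans (Finset.sum_congr rfl fun r _ => ?_))
  · rfl
  · rw [Pi.smul_apply, smul_eq_mul, mul_comm]

end

theorem jordanBlockOne_map {R S : Type*} [CommRing R] [CommRing S] (f : R →+* S) (m : ℕ) :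
    (jordanBlockOne R m).map f = jordanBlockOne S m := by
  ext i j
  simp only [jordanBlockOne, Matrix.map_apply, Matrix.of_apply]
  split_ifs <;> simp

/-- Every `B̄ ∈ GL_n(F)`, `F` a finite field of characteristic `ℓ`,
admits a minimal lift `B ∈ GL_n(W(F))` over the Witt vectors. -/
theorem exists_minimal_lift (ℓ : ℕ) [Fact ℓ.Prime] (F : Type*) [Field F] [Fintype F]
    [CharP F ℓ] (n : ℕ) (Bbar : Matrix (Fin n) (Fin n) F) (hBbar : IsUnit Bbar) :
    ∃ B : Matrix (Fin n) (Fin n) (WittVector ℓ F),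
      IsUnit B ∧ IsMinimalLift ℓ F n B Bbar := by
  obtain ⟨k, d, e, M, eqv, P₀, hirr, hord, hP₀, hconj⟩ := exists_conj_blockDiagonal ℓ n Bbar hBbar
  choose N hN hℓN hMN using hord
  choose C hCM hCN using fun i => Matrix.exists_lift_pow_eq_one (M i) (hℓN i) (hMN i)
  obtain ⟨P, hP⟩ := Matrix.exists_lift (ℓ := ℓ) P₀
  have hPu : IsUnit P := Matrix.isUnit_of_isUnit_map (by rwa [hP])
  set D := Matrix.reindex eqv eqv (Matrix.blockDiagonal'
    fun i => Matrix.kroneckerMap (· * ·) (C i) (jordanBlockOne (WittVector ℓ F) (e i))) with hD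
  have hDmap : D.map (WittVector.ghostComponent 0) = Matrix.reindex eqv eqv (Matrix.blockDiagonal'
      fun i => Matrix.kroneckerMap (· * ·) (M i) (jordanBlockOne F (e i))) := by
    rw [hD, Matrix.reindex_apply, ← Matrix.submatrix_map, Matrix.blockDiagonal'_map _ _ (map_zero _),
      Matrix.reindex_apply]
    congr 2
    ext1 i
    ext1 q r
    rw [← hCM i, ← jordanBlockOne_map (WittVector.ghostComponent 0 : WittVector ℓ F →+* F)]
    simp
  obtain ⟨u, rfl⟩ := hPu
  have hred : (u.1 * D * u⁻¹.1).map (WittVector.ghostComponent 0) = Bbar := by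
    let ρ := (WittVector.ghostComponent 0 : WittVector ℓ F →+* F).mapMatrix (m := Fin n)
    have hu : ρ u.1 = P₀ := hP
    have hρD : ρ D = _ := hDmap
    change ρ _ = Bbar
    rw [map_mul, map_mul, hρD, hu, ← hconj, ← hu, mul_assoc, ← map_mul, Units.mul_inv, map_one,
      mul_one]
  refine ⟨u.1 * D * u⁻¹.1, Matrix.isUnit_of_isUnit_map (by rwa [hred]), hred, k, d, e, C, eqv, u.1,
    fun i => ?_, fun i => ⟨N i, hN i, hℓN i, hCN i⟩, u.isUnit, ?_⟩
  · refine (Matrix.charpoly_monic _).irreducible_of_irreducible_map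
      (WittVector.ghostComponent 0 : WittVector ℓ F →+* F) _ ?_
    rw [← Matrix.charpoly_map, hCM]
    exact hirr i
  · rw [Units.inv_mul_cancel_right]
end

section
/- Let F be a finite field, W(F) its Witt ring, and B ∈ GL_n(W(F)) a minimal lift of B̄ ∈ GL_n(F). Then the W(F)-module M := M_n(W(F)) / {A·B − B^q·A : A ∈ M_n(W(F))} is flat (equivalently, free) over W(F), where q is a fixed power of the residue characteristic p (p ≠ char F = ℓ). -/
open Matrix

set_option maxSynthPendingDepth 2

open Matrix Kronecker

/-- Every solution `A` of `A * M' = M * A` over the target of `f` that comes from a matrix over the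
source comes from a solution over the source. -/
def LiftsIntertwiners {R k m n : Type*} [Semiring R] [Semiring k] [Fintype m] [Fintype n]
    (f : R →+* k) (M : Matrix m m R) (M' : Matrix n n R) : Prop :=
  ∀ A : Matrix m n R, A.map f * M'.map f = M.map f * A.map f →
    ∃ A' : Matrix m n R, A' * M' = M * A' ∧ A'.map f = A.map f

section Intertwiners

variable {R k m n : Type*} [CommRing R] [CommRing k] [Fintype m] [Fintype n]
  [DecidableEq m] [DecidableEq n]

theorem Matrix.map_ringHom_pow (f : R →+* k) (M : Matrix m m R) (r : ℕ) :
    (M ^ r).map f = M.map f ^ r :=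
  map_pow f.mapMatrix M r

theorem Matrix.mul_pow_eq_pow_mul_of_mul_eq {M : Matrix m m R} {M' : Matrix n n R}
    {A : Matrix m n R} (h : A * M' = M * A) (r : ℕ) : A * M' ^ r = M ^ r * A := by
  induction r with
  | zero => simp
  | succ r ih => rw [pow_succ, ← Matrix.mul_assoc, ih, Matrix.mul_assoc, h, ← Matrix.mul_assoc,
      pow_succ]

/-- Averaging an intertwiner of matrices of finite order invertible in `R`. -/
theorem LiftsIntertwiners.of_pow_eq_one (f : R →+* k) {S : Matrix m m R} {S' : Matrix n n R}
    {N : ℕ} (hN : 0 < N) (hNR : IsUnit (N : R)) (hS : S ^ N = 1) (hS' : S' ^ N = 1) :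
    LiftsIntertwiners f S S' := by
  intro A hA
  obtain ⟨c, hc⟩ := hNR.exists_left_inv
  set T := S' ^ (N - 1)
  have hTS : T * S' = 1 := by rw [← pow_succ, Nat.sub_add_cancel hN, hS']
  have hST : S' * T = 1 := by rw [← pow_succ', Nat.sub_add_cancel hN, hS']
  have hTN : T ^ N = 1 := by rw [← pow_mul, mul_comm, pow_mul, hS', one_pow]
  set Z := ∑ i ∈ Finset.range N, S ^ i * A * T ^ i with hZ
  have hshift : S * Z * T = Z := by
    have h1 : S * Z * T = ∑ i ∈ Finset.range N, S ^ (i + 1) * A * T ^ (i + 1) := by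
      simp only [hZ, Matrix.mul_sum, Matrix.sum_mul]
      refine Finset.sum_congr rfl fun i _ => ?_
      rw [pow_succ', pow_succ]
      simp only [Matrix.mul_assoc]
    have h2 := Finset.sum_range_succ (fun i => S ^ i * A * T ^ i) N
    rw [Finset.sum_range_succ', hS, hTN] at h2
    simp only [pow_zero] at h2
    rw [h1, hZ]
    exact add_right_cancel h2
  refine ⟨c • Z, ?_, ?_⟩
  · rw [Matrix.smul_mul, Matrix.mul_smul]
    congr 1
    calc Z * S' = S * Z * T * S' := by rw [hshift]
      _ = S * Z := by rw [Matrix.mul_assoc, hTS, Matrix.mul_one]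
  · have h1 : Z.map f = (N : k) • A.map f := by
      have : ∀ i ∈ Finset.range N, (S ^ i * A * T ^ i).map f = A.map f := by
        intro i _
        rw [Matrix.map_mul, Matrix.map_mul, map_ringHom_pow, ← mul_pow_eq_pow_mul_of_mul_eq hA,
          ← map_ringHom_pow, Matrix.mul_assoc, ← Matrix.map_mul,
          ← (show Commute S' T from hST.trans hTS.symm).mul_pow, hST, one_pow,
          Matrix.map_one _ (map_zero f) (map_one f), Matrix.mul_one]
      have hsum : Z.map f = ∑ i ∈ Finset.range N, (S ^ i * A * T ^ i).map f := by
        ext a b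
        simp only [hZ, Matrix.map_apply, Matrix.sum_apply, map_sum]
      rw [hsum, Finset.sum_congr rfl this]
      ext
      simp
    have h2 : (c • Z).map f = f c • Z.map f := by
      ext
      simp
    rw [h2, h1, smul_smul, ← map_natCast f, ← map_mul, hc, map_one, one_smul]

/-- Intertwiners into a nilpotent matrix `V'` that is cyclic in the sense witnessed by the
matrices `E i` lift, compatibly with a commuting pair `S`, `S'`. -/
theorem exists_lift_intertwiner_of_nilpotent (f : R →+* k) {S V Q : Matrix m m R}
    {S' V' : Matrix n n R} {r : ℕ} {E : ℕ → Matrix n n R}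
    (hSV : Commute S V) (hSQ : Commute S Q) (hQ : V ^ r * Q * V ^ r = V ^ r)
    (hV' : V' ^ r = 0) (hSE : ∀ i, Commute S' (E i)) (hE0 : E 0 * V' = 0)
    (hE : ∀ i, i + 1 < r → E (i + 1) * V' = E i)
    (hsum : ∑ i ∈ Finset.range r, V' ^ i * E i = 1)
    (A : Matrix m n R) (hAS : A * S' = S * A)
    (hAV : A.map f * V'.map f = V.map f * A.map f) :
    ∃ A' : Matrix m n R, A' * S' = S * A' ∧ A' * V' = V * A' ∧ A'.map f = A.map f := by
  set τ := 1 - Q * V ^ r with hτ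
  have hSτ : Commute S τ := (Commute.one_right S).sub_right (hSQ.mul_right (hSV.pow_right r))
  have hVτ : V ^ r * τ = 0 := by
    rw [hτ, mul_sub, mul_one, ← mul_assoc, hQ, sub_self]
  refine ⟨∑ i ∈ Finset.range r, V ^ i * τ * A * E i, ?_, ?_, ?_⟩
  · rw [Matrix.sum_mul, Matrix.mul_sum]
    refine Finset.sum_congr rfl fun i _ => ?_
    rw [Matrix.mul_assoc _ (E i), ← (hSE i).eq, ← Matrix.mul_assoc, Matrix.mul_assoc _ A, hAS]
    simp only [← Matrix.mul_assoc]
    rw [Matrix.mul_assoc _ τ S, ← hSτ.eq, ← Matrix.mul_assoc, (hSV.pow_right i).eq]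
  · cases r with
    | zero => simp
    | succ r =>
      rw [Matrix.sum_mul, Matrix.mul_sum, Finset.sum_range_succ', Finset.sum_range_succ]
      congr 1
      · refine Finset.sum_congr rfl fun i hi => ?_
        rw [Matrix.mul_assoc, hE i (by simpa using hi), pow_succ']
        simp only [Matrix.mul_assoc]
      · rw [Matrix.mul_assoc, hE0, Matrix.mul_zero]
        simp only [← Matrix.mul_assoc]
        rw [← pow_succ', hVτ]
        simp
  · have h1 : τ.map f * A.map f = A.map f := by
      have : τ.map f = 1 - Q.map f * V.map f ^ r := by
        rw [← map_ringHom_pow, ← Matrix.map_mul]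
        exact (map_sub f.mapMatrix _ _).trans (by rw [map_one]; rfl)
      rw [this, Matrix.sub_mul, Matrix.one_mul, Matrix.mul_assoc,
        ← mul_pow_eq_pow_mul_of_mul_eq hAV, ← map_ringHom_pow, hV']
      simp
    have h2 : (∑ i ∈ Finset.range r, V ^ i * τ * A * E i).map f
        = ∑ i ∈ Finset.range r, (V ^ i * τ * A * E i).map f := by
      ext a b
      simp only [Matrix.map_apply, Matrix.sum_apply, map_sum]
    have h3 : ∑ i ∈ Finset.range r, (V' ^ i * E i).map f = 1 := by
      rw [← map_one f.mapMatrix, ← hsum, map_sum]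
      rfl
    calc _ = ∑ i ∈ Finset.range r, A.map f * (V' ^ i * E i).map f := by
          rw [h2]
          refine Finset.sum_congr rfl fun i _ => ?_
          rw [Matrix.map_mul, Matrix.map_mul, Matrix.map_mul, Matrix.mul_assoc (Matrix.map _ _), h1,
            map_ringHom_pow, ← mul_pow_eq_pow_mul_of_mul_eq hAV, Matrix.map_mul,
            map_ringHom_pow, Matrix.mul_assoc]
      _ = A.map f := by rw [← Matrix.mul_sum, h3, Matrix.mul_one]

/-- For `S` of order dividing `N` and `V` nilpotent, suitable powers of `S * (1 + V)` in
characteristic `ℓ` extract the factors. -/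
theorem Matrix.mul_one_add_pow_eq {ℓ : ℕ} [Fact ℓ.Prime] [CharP k ℓ] {S V : Matrix m m k}
    (hSV : Commute S V) {N s a : ℕ} (hS : S ^ N = 1) (hV : V ^ ℓ ^ s = 0) :
    (a ≡ 1 [MOD N] → a ≡ 0 [MOD ℓ ^ s] → (S * (1 + V)) ^ a = S) ∧
    (a ≡ 0 [MOD N] → a ≡ 1 [MOD ℓ ^ s] → (S * (1 + V)) ^ a = 1 + V) := by
  have hU : (1 + V) ^ ℓ ^ s = 1 := by
    rw [(Commute.one_left V).add_pow_prime_pow_eq Fact.out, hV]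
    have : (ℓ : Matrix m m k) = 0 := by
      rw [← map_natCast (Matrix.scalar m), CharP.cast_eq_zero, map_zero]
    simp [this]
  have hc : Commute S (1 + V) := (Commute.one_right S).add_right hSV
  constructor <;> intro h1 h2
  · rw [hc.mul_pow, pow_eq_pow_of_modEq h1 hS, pow_eq_pow_of_modEq h2 hU, pow_one, pow_zero,
      mul_one]
  · rw [hc.mul_pow, pow_eq_pow_of_modEq h1 hS, pow_eq_pow_of_modEq h2 hU, pow_one, pow_zero,
      one_mul]

theorem Matrix.exists_one_add_pow_sub_one_eq {V : Matrix m m R} (hV : IsNilpotent V) {q : ℕ}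
    (hq : IsUnit (q : R)) :
    ∃ u : (Matrix m m R)ˣ, (1 + V) ^ q = 1 + V * u ∧
      ∀ X, Commute X V → Commute X (u : Matrix m m R) := by
  set w := ∑ i ∈ Finset.range q, (1 + V) ^ i with hw
  have hcomm : ∀ X, Commute X V → Commute X w := fun X hX =>
    Commute.sum_right _ _ _ fun i _ => ((Commute.one_right X).add_right hX).pow_right i
  have hdvd : ∃ y, w - q = V * y ∧ Commute V y := by
    refine ⟨∑ i ∈ Finset.range q, ∑ j ∈ Finset.range i, (1 + V) ^ j, ?_, ?_⟩
    · have (i : ℕ) : V * ∑ j ∈ Finset.range i, (1 + V) ^ j = (1 + V) ^ i - 1 := by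
        simpa using mul_geom_sum (1 + V) i
      simp [Finset.mul_sum, ← hw, this]
    · exact Commute.sum_right _ _ _ fun i _ => Commute.sum_right _ _ _ fun j _ =>
        ((Commute.one_right V).add_right (Commute.refl V)).pow_right j
  obtain ⟨y, hy, hVy⟩ := hdvd
  have hnil : IsNilpotent (w - q) := hy ▸ hVy.isNilpotent_mul_right hV
  have hqu : IsUnit (q : Matrix m m R) := by
    simpa using hq.map (Matrix.scalar m)
  have hwu : IsUnit w := by
    have := hnil.isUnit_add_left_of_commute hqu (Nat.cast_commute q _).symm
    rwa [add_sub_cancel] at this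
  obtain ⟨u, hu⟩ := hwu
  refine ⟨u, ?_, fun X hX => hu ▸ hcomm X hX⟩
  rw [hu, hw]
  have := mul_geom_sum (1 + V) q
  rw [add_sub_cancel_left] at this
  rw [this, add_sub_cancel]

theorem LiftsIntertwiners.mul_one_add (f : R →+* k) {ℓ : ℕ} [Fact ℓ.Prime] [CharP k ℓ]
    (hunit : ∀ a : ℕ, ¬ ℓ ∣ a → IsUnit (a : R)) {q : ℕ} (hq : ¬ ℓ ∣ q) {N : ℕ} (hN : 0 < N)
    (hNℓ : ¬ ℓ ∣ N) {S V Q : Matrix m m R} {S' V' : Matrix n n R} {r : ℕ}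
    {E : ℕ → Matrix n n R} (hS : S ^ N = 1) (hS' : S' ^ N = 1) (hV : IsNilpotent V)
    (hSV : Commute S V) (hSQ : Commute S Q) (hQ : V ^ r * Q * V ^ r = V ^ r)
    (hV' : V' ^ r = 0) (hSV' : Commute S' V') (hSE : ∀ i, Commute S' (E i)) (hE0 : E 0 * V' = 0)
    (hE : ∀ i, i + 1 < r → E (i + 1) * V' = E i)
    (hsum : ∑ i ∈ Finset.range r, V' ^ i * E i = 1) :
    LiftsIntertwiners f ((S * (1 + V)) ^ q) (S' * (1 + V')) := by
  intro A hA
  obtain ⟨u, hu, hcu⟩ := exists_one_add_pow_sub_one_eq hV (hunit q hq)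
  have hSu : Commute S u := hcu S hSV
  have hVu : Commute V u := hcu V (Commute.refl V)
  have hSq : (S * (1 + V)) ^ q = S ^ q * (1 + V * u) := by
    rw [((Commute.one_right S).add_right hSV).mul_pow, hu]
  have hSqW : Commute (S ^ q) (V * u) := (hSV.mul_right hSu).pow_left q
  rw [hSq] at hA ⊢
  obtain ⟨t, ht⟩ := hV
  have hWt : (V * u) ^ t = 0 := by rw [hVu.mul_pow, ht, zero_mul]
  obtain ⟨s, hts, hrs⟩ : ∃ s, t ≤ ℓ ^ s ∧ r ≤ ℓ ^ s := by
    have hlt := Nat.lt_pow_self (n := t + r) (Fact.out : ℓ.Prime).one_lt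
    exact ⟨t + r, by lia, by lia⟩
  have hcop : N.Coprime (ℓ ^ s) :=
    (((Nat.Prime.coprime_iff_not_dvd Fact.out).2 hNℓ).pow_left s).symm
  have hW_map : ((V * u).map f) ^ ℓ ^ s = 0 := by
    rw [← map_ringHom_pow, pow_eq_zero_of_le hts hWt, Matrix.map_zero _ (map_zero f)]
  have hV_map : (V'.map f) ^ ℓ ^ s = 0 := by
    rw [← map_ringHom_pow, pow_eq_zero_of_le hrs hV', Matrix.map_zero _ (map_zero f)]
  have hS_map : ((S ^ q).map f) ^ N = 1 := by
    rw [← map_ringHom_pow, ← pow_mul, mul_comm, pow_mul, hS, one_pow,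
      Matrix.map_one _ (map_zero f) (map_one f)]
  have hS'_map : (S'.map f) ^ N = 1 := by
    rw [← map_ringHom_pow, hS', Matrix.map_one _ (map_zero f) (map_one f)]
  have hc : Commute ((S ^ q).map f) ((V * u).map f) := hSqW.map f.mapMatrix
  have hc' : Commute (S'.map f) (V'.map f) := hSV'.map f.mapMatrix
  have h1 : ((1 + V * u).map f) = 1 + (V * u).map f :=
    (map_add f.mapMatrix _ _).trans (by rw [map_one]; rfl)
  have h1' : ((1 + V').map f) = 1 + V'.map f :=
    (map_add f.mapMatrix _ _).trans (by rw [map_one]; rfl)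
  rw [Matrix.map_mul, Matrix.map_mul, h1, h1'] at hA
  obtain ⟨a, ha, ha'⟩ := Nat.chineseRemainder hcop 1 0
  obtain ⟨b, hb, hb'⟩ := Nat.chineseRemainder hcop 0 1
  have hAS := mul_pow_eq_pow_mul_of_mul_eq hA a
  rw [(mul_one_add_pow_eq hc hS_map hW_map).1 ha ha',
    (mul_one_add_pow_eq hc' hS'_map hV_map).1 ha ha'] at hAS
  have hAV := mul_pow_eq_pow_mul_of_mul_eq hA b
  rw [(mul_one_add_pow_eq hc hS_map hW_map).2 hb hb',
    (mul_one_add_pow_eq hc' hS'_map hV_map).2 hb hb', Matrix.mul_add, Matrix.add_mul,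
    Matrix.mul_one, Matrix.one_mul, add_right_inj] at hAV
  obtain ⟨A₁, hA₁, hA₁A⟩ := LiftsIntertwiners.of_pow_eq_one f hN (hunit N hNℓ)
    (S := S ^ q) (by rw [← pow_mul, mul_comm, pow_mul, hS, one_pow]) hS' A hAS
  rw [← hA₁A] at hAV
  have hSui : Commute S (u⁻¹ : (Matrix m m R)ˣ) := hSu.units_inv_right
  obtain ⟨A₂, hA₂S, hA₂V, hA₂A⟩ := exists_lift_intertwiner_of_nilpotent f (r := r)
    (Q := ((u⁻¹ : (Matrix m m R)ˣ) : Matrix m m R) ^ r * Q) hSqW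
    (((hSui.pow_right r).mul_right hSQ).pow_left q)
    (by
      rw [hVu.mul_pow, ← mul_assoc, ← mul_assoc, mul_assoc (V ^ r), ← Units.val_pow_eq_pow_val,
        ← Units.val_pow_eq_pow_val, ← Units.val_mul, inv_pow, mul_inv_cancel, Units.val_one,
        mul_one, hQ])
    hV' hSE hE0 hE hsum A₁ hA₁ hAV
  refine ⟨A₂, ?_, hA₂A.trans hA₁A⟩
  rw [← Matrix.mul_assoc, hA₂S, Matrix.mul_assoc, Matrix.mul_add, hA₂V, Matrix.mul_one,
    Matrix.mul_assoc (S ^ q), Matrix.add_mul, Matrix.one_mul]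

theorem LiftsIntertwiners.blockDiagonal' {ι : Type*} [Fintype ι] [DecidableEq ι] {d : ι → Type*}
    [∀ i, Fintype (d i)] [∀ i, DecidableEq (d i)] (f : R →+* k) {M M' : ∀ i, Matrix (d i) (d i) R}
    (h : ∀ i j, LiftsIntertwiners f (M i) (M' j)) :
    LiftsIntertwiners f (Matrix.blockDiagonal' M) (Matrix.blockDiagonal' M') := by
  have hr {K : Type _} [CommRing K] (A : Matrix (Σ i, d i) (Σ i, d i) K)
      (D : ∀ i, Matrix (d i) (d i) K) (i j x y) :
      (A * Matrix.blockDiagonal' D) ⟨i, x⟩ ⟨j, y⟩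
        = (Matrix.of (fun x y => A ⟨i, x⟩ ⟨j, y⟩) * D j) x y := by
    simp only [Matrix.mul_apply, Fintype.sum_sigma, Matrix.of_apply]
    rw [Finset.sum_eq_single j]
    · simp
    · intro b _ hb
      simp [Matrix.blockDiagonal'_apply_ne _ _ _ hb]
    · simp
  have hl {K : Type _} [CommRing K] (A : Matrix (Σ i, d i) (Σ i, d i) K)
      (D : ∀ i, Matrix (d i) (d i) K) (i j x y) :
      (Matrix.blockDiagonal' D * A) ⟨i, x⟩ ⟨j, y⟩
        = (D i * Matrix.of (fun x y => A ⟨i, x⟩ ⟨j, y⟩)) x y := by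
    simp only [Matrix.mul_apply, Fintype.sum_sigma, Matrix.of_apply]
    rw [Finset.sum_eq_single i]
    · simp
    · intro b _ hb
      simp [Matrix.blockDiagonal'_apply_ne _ _ _ hb.symm]
    · simp
  intro A hA
  rw [← Matrix.map_mul, ← Matrix.map_mul] at hA
  have hblock (i j) := h i j (Matrix.of fun x y => A ⟨i, x⟩ ⟨j, y⟩) <| by
    rw [← Matrix.map_mul, ← Matrix.map_mul]
    ext x y
    have := congrFun (congrFun hA ⟨i, x⟩) ⟨j, y⟩
    rwa [Matrix.map_apply, Matrix.map_apply, hr, hl] at this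
  choose X hX hXA using hblock
  refine ⟨Matrix.of fun a b => X a.1 b.1 a.2 b.2, ?_, ?_⟩
  · ext ⟨i, x⟩ ⟨j, y⟩
    rw [hr, hl]
    exact congrFun (congrFun (hX i j) x) y
  · ext ⟨i, x⟩ ⟨j, y⟩
    exact congrFun (congrFun (hXA i j) x) y

theorem LiftsIntertwiners.of_conj (f : R →+* k) {M D : Matrix m m R} {M' D' : Matrix n n R}
    (h : LiftsIntertwiners f D D') (P : (Matrix m m R)ˣ) (P' : (Matrix n n R)ˣ)
    (hM : M * P.val = P.val * D) (hM' : M' * P'.val = P'.val * D') : LiftsIntertwiners f M M' := by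
  intro A hA
  rw [← Matrix.map_mul, ← Matrix.map_mul] at hA
  have hMi : P⁻¹.val * M = D * P⁻¹.val := by
    rw [Units.inv_mul_eq_iff_eq_mul, ← mul_assoc, ← hM, Units.mul_inv_cancel_right]
  have hMi' : P'⁻¹.val * M' = D' * P'⁻¹.val := by
    rw [Units.inv_mul_eq_iff_eq_mul, ← mul_assoc, ← hM', Units.mul_inv_cancel_right]
  obtain ⟨X, hX, hXA⟩ := h (P⁻¹.val * A * P'.val) <| by
    have hl : P⁻¹.val * A * P'.val * D' = P⁻¹.val * (A * M') * P'.val := by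
      simp only [Matrix.mul_assoc, hM']
    have hr : D * (P⁻¹.val * A * P'.val) = P⁻¹.val * (M * A) * P'.val := by
      simp only [← Matrix.mul_assoc, hMi]
    rw [← Matrix.map_mul, ← Matrix.map_mul, hl, hr, Matrix.map_mul, Matrix.map_mul, hA,
      ← Matrix.map_mul, ← Matrix.map_mul]
  refine ⟨P.val * X * P'⁻¹.val, ?_, ?_⟩
  · rw [Matrix.mul_assoc, hMi', ← Matrix.mul_assoc, Matrix.mul_assoc _ X D', hX,
      ← Matrix.mul_assoc, ← hM]
    simp only [Matrix.mul_assoc]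
  · rw [Matrix.map_mul, Matrix.map_mul, hXA, ← Matrix.map_mul, ← Matrix.map_mul]
    congr 1
    rw [← Matrix.mul_assoc, ← Matrix.mul_assoc, Units.mul_inv, Matrix.one_mul, Matrix.mul_assoc,
      Units.mul_inv, Matrix.mul_one]

end Intertwiners

theorem LiftsIntertwiners.reindex {R k m n m' n' : Type*} [CommRing R] [CommRing k] [Fintype m]
    [Fintype n] [Fintype m'] [Fintype n'] (f : R →+* k)
    {M : Matrix m m R} {M' : Matrix n n R} (h : LiftsIntertwiners f M M')
    (em : m ≃ m') (en : n ≃ n') :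
    LiftsIntertwiners f (Matrix.reindex em em M) (Matrix.reindex en en M') := by
  intro A hA
  rw [← Matrix.map_mul, ← Matrix.map_mul] at hA
  obtain ⟨X, hX, hXA⟩ := h (A.submatrix em en) <| by
    rw [← Matrix.map_mul, ← Matrix.map_mul]
    have := congrArg (fun Y => Y.submatrix em en) hA
    simpa [← Matrix.submatrix_map, ← Matrix.submatrix_mul_equiv _ _ em en en,
      ← Matrix.submatrix_mul_equiv _ _ em em en] using this
  refine ⟨Matrix.reindex em en X, ?_, ?_⟩
  · simp [hX]
  · have := congrArg (fun Y => Y.submatrix em.symm en.symm) hXA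
    simpa [← Matrix.submatrix_map] using this

section NilpotentJordanBlock

variable (R : Type*) [CommRing R]

/-- The nilpotent Jordan block of size `m`. -/
def nilpotentJordanBlock (m : ℕ) : Matrix (Fin m) (Fin m) R :=
  Matrix.of fun i j => if (i : ℕ) + 1 = j then 1 else 0

/-- The matrix unit in the last row and the `i`-th column from the right. -/
def lastRowUnit (m i : ℕ) : Matrix (Fin m) (Fin m) R :=
  Matrix.of fun a b => if (a : ℕ) + 1 = m ∧ (b : ℕ) + 1 + i = m then 1 else 0

theorem jordanBlockOne_eq_one_add (m : ℕ) :
    jordanBlockOne R m = 1 + nilpotentJordanBlock R m := by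
  ext i j
  simp only [jordanBlockOne, nilpotentJordanBlock, Matrix.add_apply, Matrix.of_apply,
    Matrix.one_apply, Fin.ext_iff]
  split_ifs <;> first | lia | simp

theorem nilpotentJordanBlock_pow_apply (m r : ℕ) (i j : Fin m) :
    (nilpotentJordanBlock R m ^ r) i j = if (i : ℕ) + r = j then 1 else 0 := by
  induction r generalizing i with
  | zero => simp [Matrix.one_apply, Fin.ext_iff]
  | succ r ih =>
    simp only [pow_succ', Matrix.mul_apply, ih]
    by_cases h : (i : ℕ) + 1 < m
    · rw [Finset.sum_eq_single ⟨i + 1, h⟩]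
      · simp [nilpotentJordanBlock, add_assoc, add_comm 1 r]
      · intro b _ hb
        have : (i : ℕ) + 1 ≠ b := fun h' => hb (Fin.ext h'.symm)
        simp [nilpotentJordanBlock, this]
      · simp
    · rw [Finset.sum_eq_zero, if_neg (by lia)]
      intro b _
      have : (i : ℕ) + 1 ≠ b := by lia
      simp [nilpotentJordanBlock, this]

theorem nilpotentJordanBlock_pow_self (m : ℕ) : nilpotentJordanBlock R m ^ m = 0 := by
  ext i j
  rw [nilpotentJordanBlock_pow_apply, if_neg (by lia), Matrix.zero_apply]

theorem nilpotentJordanBlock_pow_mul_transpose_mul (m r : ℕ) :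
    nilpotentJordanBlock R m ^ r * (nilpotentJordanBlock R m ^ r)ᵀ * nilpotentJordanBlock R m ^ r
      = nilpotentJordanBlock R m ^ r := by
  have h : (nilpotentJordanBlock R m ^ r) * (nilpotentJordanBlock R m ^ r)ᵀ
      = Matrix.diagonal fun i : Fin m => if (i : ℕ) + r < m then 1 else 0 := by
    ext i j
    simp only [Matrix.mul_apply, Matrix.transpose_apply, nilpotentJordanBlock_pow_apply,
      Matrix.diagonal_apply]
    by_cases h : (i : ℕ) + r < m
    · rw [Finset.sum_eq_single ⟨i + r, h⟩]
      · simp [h, Fin.ext_iff, eq_comm]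
      · intro b _ hb
        have : (i : ℕ) + r ≠ b := fun h' => hb (Fin.ext h'.symm)
        simp [this]
      · simp
    · rw [Finset.sum_eq_zero]
      · simp [h]
      · intro b _
        have : (i : ℕ) + r ≠ b := by lia
        simp [this]
  rw [h]
  ext i j
  rw [Matrix.diagonal_mul, nilpotentJordanBlock_pow_apply]
  split_ifs <;> lia

theorem lastRowUnit_zero_mul (m : ℕ) : lastRowUnit R m 0 * nilpotentJordanBlock R m = 0 := by
  ext a b
  rw [Matrix.mul_apply, Finset.sum_eq_zero, Matrix.zero_apply]
  intro c _
  simp only [lastRowUnit, nilpotentJordanBlock, Matrix.of_apply]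
  split_ifs <;> lia

theorem lastRowUnit_succ_mul {m i : ℕ} (hi : i + 1 < m) :
    lastRowUnit R m (i + 1) * nilpotentJordanBlock R m = lastRowUnit R m i := by
  ext a b
  rw [Matrix.mul_apply, Finset.sum_eq_single ⟨m - (i + 2), by lia⟩]
  · simp only [lastRowUnit, nilpotentJordanBlock, Matrix.of_apply]
    split_ifs <;> lia
  · intro c _ hc
    have : (c : ℕ) ≠ m - (i + 2) := fun h => hc (Fin.ext h)
    simp only [lastRowUnit, nilpotentJordanBlock, Matrix.of_apply]
    split_ifs <;> lia
  · simp

theorem sum_nilpotentJordanBlock_pow_mul_lastRowUnit (m : ℕ) :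
    ∑ i ∈ Finset.range m, nilpotentJordanBlock R m ^ i * lastRowUnit R m i = 1 := by
  have h (i : ℕ) (a b : Fin m) : (nilpotentJordanBlock R m ^ i * lastRowUnit R m i) a b
      = if (a : ℕ) + 1 + i = m ∧ (b : ℕ) + 1 + i = m then 1 else 0 := by
    have := a.2
    rw [Matrix.mul_apply, Finset.sum_eq_single ⟨m - 1, by lia⟩]
    · simp only [nilpotentJordanBlock_pow_apply, lastRowUnit, Matrix.of_apply]
      split_ifs <;> lia
    · intro c _ hc
      have : (c : ℕ) ≠ m - 1 := fun h => hc (Fin.ext h)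
      simp only [nilpotentJordanBlock_pow_apply, lastRowUnit, Matrix.of_apply]
      split_ifs <;> lia
    · simp
  ext a b
  have := a.2
  simp only [Matrix.sum_apply, h]
  rw [Finset.sum_eq_single (m - 1 - a)]
  · simp only [Matrix.one_apply, Fin.ext_iff]
    split_ifs <;> lia
  · intro c _ hc
    rw [if_neg (by lia)]
  · intro hc
    simp only [Finset.mem_range] at hc
    lia

end NilpotentJordanBlock

section Kronecker

variable {R m n : Type*} [CommRing R] [Fintype m] [Fintype n] [DecidableEq m] [DecidableEq n]

theorem Matrix.one_kronecker_pow (Y : Matrix n n R) (r : ℕ) :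
    ((1 : Matrix m m R) ⊗ₖ Y) ^ r = 1 ⊗ₖ (Y ^ r) := by
  induction r with
  | zero => simp
  | succ r ih => rw [pow_succ, ih, ← Matrix.mul_kronecker_mul, one_mul, pow_succ]

theorem Matrix.kronecker_one_pow (X : Matrix m m R) (r : ℕ) :
    (X ⊗ₖ (1 : Matrix n n R)) ^ r = (X ^ r) ⊗ₖ 1 := by
  induction r with
  | zero => simp
  | succ r ih => rw [pow_succ, ih, ← Matrix.mul_kronecker_mul, one_mul, pow_succ]

theorem Matrix.commute_kronecker_one_one_kronecker (X : Matrix m m R) (Y : Matrix n n R) :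
    Commute (X ⊗ₖ (1 : Matrix n n R)) ((1 : Matrix m m R) ⊗ₖ Y) := by
  rw [commute_iff_eq, ← Matrix.mul_kronecker_mul, ← Matrix.mul_kronecker_mul]
  simp

theorem kronecker_jordanBlockOne (C : Matrix m m R) (e : ℕ) :
    C ⊗ₖ jordanBlockOne R e = C ⊗ₖ 1 * (1 + 1 ⊗ₖ nilpotentJordanBlock R e) := by
  rw [← Matrix.one_kronecker_one (m := m) (n := Fin e), ← Matrix.kronecker_add,
    ← Matrix.mul_kronecker_mul, mul_one, one_mul, jordanBlockOne_eq_one_add]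

theorem LiftsIntertwiners.kronecker_jordanBlockOne {k : Type*} [CommRing k] (f : R →+* k) {ℓ : ℕ}
    [Fact ℓ.Prime] [CharP k ℓ] (hunit : ∀ a : ℕ, ¬ ℓ ∣ a → IsUnit (a : R)) {q : ℕ}
    (hq : ¬ ℓ ∣ q) {N : ℕ} (hN : 0 < N) (hNℓ : ¬ ℓ ∣ N) {C : Matrix m m R} {C' : Matrix n n R}
    (hC : C ^ N = 1) (hC' : C' ^ N = 1) (e e' : ℕ) :
    LiftsIntertwiners f ((C ⊗ₖ jordanBlockOne R e) ^ q) (C' ⊗ₖ jordanBlockOne R e') := by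
  rw [_root_.kronecker_jordanBlockOne, _root_.kronecker_jordanBlockOne]
  refine LiftsIntertwiners.mul_one_add f hunit hq hN hNℓ (r := e')
    (Q := 1 ⊗ₖ (nilpotentJordanBlock R e ^ e')ᵀ) (E := fun i => 1 ⊗ₖ lastRowUnit R e' i)
    (by rw [Matrix.kronecker_one_pow, hC, Matrix.one_kronecker_one])
    (by rw [Matrix.kronecker_one_pow, hC', Matrix.one_kronecker_one])
    ⟨e, by rw [Matrix.one_kronecker_pow, nilpotentJordanBlock_pow_self, Matrix.kronecker_zero]⟩
    (Matrix.commute_kronecker_one_one_kronecker _ _)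
    (Matrix.commute_kronecker_one_one_kronecker _ _) ?_ ?_
    (Matrix.commute_kronecker_one_one_kronecker _ _)
    (fun i => Matrix.commute_kronecker_one_one_kronecker _ _) ?_ (fun i hi => ?_) ?_
  · rw [Matrix.one_kronecker_pow, ← Matrix.mul_kronecker_mul, ← Matrix.mul_kronecker_mul,
      nilpotentJordanBlock_pow_mul_transpose_mul, one_mul, one_mul]
  · rw [Matrix.one_kronecker_pow, nilpotentJordanBlock_pow_self, Matrix.kronecker_zero]
  · rw [← Matrix.mul_kronecker_mul, lastRowUnit_zero_mul, Matrix.kronecker_zero]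
  · rw [← Matrix.mul_kronecker_mul, lastRowUnit_succ_mul R hi, one_mul]
  · have (i : ℕ) : ((1 : Matrix n n R) ⊗ₖ nilpotentJordanBlock R e') ^ i * 1 ⊗ₖ lastRowUnit R e' i
        = 1 ⊗ₖ (nilpotentJordanBlock R e' ^ i * lastRowUnit R e' i) := by
      rw [Matrix.one_kronecker_pow, ← Matrix.mul_kronecker_mul, one_mul]
    rw [← Matrix.one_kronecker_one, ← sum_nilpotentJordanBlock_pow_mul_lastRowUnit]
    ext
    simp only [this, Matrix.sum_apply, Matrix.kroneckerMap_apply, Finset.mul_sum]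

end Kronecker

/-- Over a discrete valuation ring, or any domain in which every nonzero element is associated to a
power of `ϖ`, lifting of solutions modulo `ϖ` gives torsion-freeness of the cokernel. -/
theorem LiftsIntertwiners.isTorsionFree {R k n : Type*} [CommRing R] [IsDomain R] [CommRing k]
    [Fintype n] [DecidableEq n] {f : R →+* k} {ϖ : R} (hϖ : ϖ ≠ 0) (hfϖ : ∀ x, f x = 0 ↔ ϖ ∣ x)
    (hR : ∀ x : R, x ≠ 0 → ∃ r : ℕ, Associated (ϖ ^ r) x) {M M' : Matrix n n R}
    (h : LiftsIntertwiners f M M') :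
    Module.IsTorsionFree R
      (Matrix n n R ⧸ LinearMap.range (LinearMap.mulRight R M' - LinearMap.mulLeft R M)) := by
  set T := LinearMap.mulRight R M' - LinearMap.mulLeft R M with hT
  have hTapp (A : Matrix n n R) : T A = A * M' - M * A := rfl
  have key (X : Matrix n n R) (hX : ϖ • X ∈ LinearMap.range T) : X ∈ LinearMap.range T := by
    obtain ⟨A, hA⟩ := hX
    obtain ⟨A', hA', hAA'⟩ := h A <| by
      rw [← Matrix.map_mul, ← Matrix.map_mul]
      ext i j
      have := congrFun (congrFun hA i) j
      rw [hTapp, Matrix.sub_apply, Matrix.smul_apply, smul_eq_mul] at this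
      rw [Matrix.map_apply, Matrix.map_apply, ← sub_eq_zero, ← map_sub, hfϖ]
      exact ⟨_, this⟩
    have hdvd (i j) : ϖ ∣ (A - A') i j := by
      rw [← hfϖ, Matrix.sub_apply, map_sub, sub_eq_zero]
      exact (congrFun (congrFun hAA' i) j).symm
    choose Z hZ using hdvd
    have hZ' : A - A' = ϖ • Matrix.of Z := by
      ext i j
      exact hZ i j
    refine ⟨Matrix.of Z, smul_right_injective _ hϖ ?_⟩
    have hTA' : T A' = 0 := by rw [hTapp, hA', sub_self]
    change ϖ • T _ = ϖ • X
    rw [← map_smul, ← hZ', map_sub, hTA', sub_zero, hA]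
  have hpow (r : ℕ) (X : Matrix n n R) (hX : ϖ ^ r • X ∈ LinearMap.range T) :
      X ∈ LinearMap.range T := by
    induction r generalizing X with
    | zero => simpa using hX
    | succ r ih => exact key X (ih _ (by rwa [← mul_smul, ← pow_succ]))
  rw [Module.isTorsionFree_iff_smul_eq_zero]
  intro x y hxy
  refine or_iff_not_imp_left.2 fun hx => ?_
  obtain ⟨r, u, rfl⟩ := hR x hx
  obtain ⟨X, rfl⟩ := Submodule.Quotient.mk_surjective _ y
  rw [← Submodule.Quotient.mk_smul, Submodule.Quotient.mk_eq_zero, mul_smul] at hxy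
  have := hpow r _ hxy
  rw [Submodule.Quotient.mk_eq_zero]
  simpa [smul_smul] using Submodule.smul_mem _ (↑u⁻¹ : R) this

theorem WittVector.constantCoeff_eq_zero_iff {ℓ : ℕ} [Fact ℓ.Prime] {F : Type*} [Field F]
    [CharP F ℓ] [PerfectRing F ℓ] (x : WittVector ℓ F) :
    WittVector.constantCoeff x = 0 ↔ (ℓ : WittVector ℓ F) ∣ x := by
  constructor
  · intro h
    rcases eq_or_ne x 0 with rfl | hx
    · exact dvd_zero _
    obtain ⟨r, b, rfl⟩ := WittVector.exists_eq_pow_p_mul' x hx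
    cases r with
    | zero =>
      have := (b.isUnit.map (WittVector.constantCoeff (p := ℓ) (R := F))).ne_zero
      simp_all
    | succ r => exact ⟨ℓ ^ r * b, by ring⟩
  · rintro ⟨y, rfl⟩
    rw [map_mul, map_natCast, CharP.cast_eq_zero, zero_mul]

theorem WittVector.isUnit_natCast {ℓ : ℕ} [Fact ℓ.Prime] {F : Type*} [Field F]
    [CharP F ℓ] {a : ℕ} (ha : ¬ ℓ ∣ a) : IsUnit (a : WittVector ℓ F) := by
  refine WittVector.isUnit_of_coeff_zero_ne_zero _ ?_
  change WittVector.constantCoeff (a : WittVector ℓ F) ≠ 0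
  rwa [map_natCast, Ne, CharP.cast_eq_zero_iff F ℓ]

/-- If `B ∈ GL_n(W(F))` is a minimal lift of `B̄ ∈ GL_n(F)` and `q` is a
power of a prime `p ≠ ℓ`, then `M_n(W(F)) / {A·B − B^q·A}` is a flat (equivalently,
free) `W(F)`-module. -/
theorem minimal_lift_quotient_flat (ℓ : ℕ) [Fact ℓ.Prime] (F : Type*) [Field F]
    [Fintype F] [CharP F ℓ] (n : ℕ)
    (Bbar : Matrix (Fin n) (Fin n) F) (hBbar : IsUnit Bbar)
    (B : Matrix (Fin n) (Fin n) (WittVector ℓ F)) (hB : IsUnit B)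
    (hlift : IsMinimalLift ℓ F n B Bbar)
    (p q : ℕ) (hp : p.Prime) (hpl : p ≠ ℓ) (hq : ∃ k : ℕ, q = p ^ k) :
    Module.Flat (WittVector ℓ F)
      (Matrix (Fin n) (Fin n) (WittVector ℓ F) ⧸
        LinearMap.range
          (LinearMap.mulRight (WittVector ℓ F) B -
           LinearMap.mulLeft (WittVector ℓ F) (B ^ q))) := by
  obtain ⟨-, b, d, e, C, eqv, P, -, hC, hP, hBP⟩ := hlift
  have hqℓ : ¬ ℓ ∣ q := by
    obtain ⟨s, rfl⟩ := hq
    exact fun h => hpl ((Nat.prime_dvd_prime_iff_eq Fact.out hp).1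
      ((Fact.out : ℓ.Prime).dvd_of_dvd_pow h)).symm
  choose N hN hNℓ hCN using hC
  have hlifts : LiftsIntertwiners (WittVector.constantCoeff (p := ℓ) (R := F)) (B ^ q) B := by
    obtain ⟨P, rfl⟩ := hP
    refine LiftsIntertwiners.of_conj _ (D := (Matrix.reindex eqv eqv (Matrix.blockDiagonal'
        fun i => C i ⊗ₖ jordanBlockOne (WittVector ℓ F) (e i))) ^ q) ?_ P P ?_ hBP
    · have hpow : (Matrix.reindex eqv eqv (Matrix.blockDiagonal'
          fun i => C i ⊗ₖ jordanBlockOne (WittVector ℓ F) (e i))) ^ q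
          = Matrix.reindex eqv eqv (Matrix.blockDiagonal'
            fun i => (C i ⊗ₖ jordanBlockOne (WittVector ℓ F) (e i)) ^ q) := by
        rw [← Matrix.coe_reindexAlgEquiv (WittVector ℓ F) (WittVector ℓ F), ← map_pow,
          ← Matrix.blockDiagonal'_pow]
        rfl
      rw [hpow]
      refine LiftsIntertwiners.reindex _ (LiftsIntertwiners.blockDiagonal' _ fun i j => ?_) _ _
      refine LiftsIntertwiners.kronecker_jordanBlockOne _
        (fun a ha => WittVector.isUnit_natCast ha) hqℓ (Nat.mul_pos (hN i) (hN j))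
        (fun h => ((Fact.out : ℓ.Prime).dvd_mul.1 h).elim (hNℓ i) (hNℓ j)) ?_ ?_ _ _
      · rw [pow_mul, hCN, one_pow]
      · rw [mul_comm, pow_mul, hCN, one_pow]
    · exact (Matrix.mul_pow_eq_pow_mul_of_mul_eq hBP.symm q).symm
  rw [IsDedekindDomain.flat_iff_torsion_eq_bot, ← Submodule.isTorsionFree_iff_torsion_eq_bot]
  exact hlifts.isTorsionFree (WittVector.irreducible ℓ).ne_zero
    WittVector.constantCoeff_eq_zero_iff fun x hx => by
      obtain ⟨r, u, rfl⟩ := WittVector.exists_eq_pow_p_mul' x hx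
      exact ⟨r, u, rfl⟩
end
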